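/- For every real m×m matrix Z, the support function of the maximal correlation set satisfies φ_{C_max}(Z) = ‖AᵀZB‖_1 = s_1 + s_2 + s_3, the sum of the singular values of the real 3×3 matrix AᵀZB. -/

import Mathlib

open Matrix Kronecker
open scoped ENNReal ComplexOrder

namespace BellCorr

/-- The three Pauli matrices. -/
noncomputable def pauli (k : Fin 3) : Matrix (Fin 2) (Fin 2) ℂ :=
  if k = 0 then !![0, 1; 1, 0]
  else if k = 1 then !![0, -Complex.I; Complex.I, 0]
  else !![1, 0; 0, -1]

/-- The observable `Â_i = ∑ k A i k • σ_k` associated with row `i` of `A`. -/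
noncomputable def obs {m : ℕ} (A : Matrix (Fin m) (Fin 3) ℝ) (i : Fin m) :
    Matrix (Fin 2) (Fin 2) ℂ :=
  ∑ k : Fin 3, (A i k : ℂ) • pauli k

/-- The correlation map `Φ_AB`, sending a 4×4 complex matrix to the real m×m matrix
with entries `Tr[ρ (Â_i ⊗ B̂_j)]`. -/
noncomputable def corr {m : ℕ} (A B : Matrix (Fin m) (Fin 3) ℝ)
    (ρ : Matrix (Fin 2 × Fin 2) (Fin 2 × Fin 2) ℂ) : Matrix (Fin m) (Fin m) ℝ :=
  Matrix.of fun i j => ((ρ * (obs A i ⊗ₖ obs B j)).trace).re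

/-- Separable states: convex hull of products of 2×2 PSD trace-one matrices. -/
noncomputable def Ssep : Set (Matrix (Fin 2 × Fin 2) (Fin 2 × Fin 2) ℂ) :=
  convexHull ℝ {ρ | ∃ ρA ρB : Matrix (Fin 2) (Fin 2) ℂ,
    ρA.PosSemidef ∧ ρA.trace = 1 ∧ ρB.PosSemidef ∧ ρB.trace = 1 ∧ ρ = ρA ⊗ₖ ρB}

/-- Quantum states: 4×4 PSD matrices of trace one. -/
def Sqm : Set (Matrix (Fin 2 × Fin 2) (Fin 2 × Fin 2) ℂ) :=
  {ρ | ρ.PosSemidef ∧ ρ.trace = 1}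

/-- Maximal-tensor-product states: self-adjoint trace-one matrices pairing
nonnegatively with every product of PSD matrices. -/
def Smax : Set (Matrix (Fin 2 × Fin 2) (Fin 2 × Fin 2) ℂ) :=
  {ρ | ρ.IsHermitian ∧ ρ.trace = 1 ∧
    ∀ P Q : Matrix (Fin 2) (Fin 2) ℂ, P.PosSemidef → Q.PosSemidef →
      0 ≤ ((ρ * (P ⊗ₖ Q)).trace).re}

noncomputable def Csep {m : ℕ} (A B : Matrix (Fin m) (Fin 3) ℝ) :
    Set (Matrix (Fin m) (Fin m) ℝ) := corr A B '' Ssep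

noncomputable def Cqm {m : ℕ} (A B : Matrix (Fin m) (Fin 3) ℝ) :
    Set (Matrix (Fin m) (Fin m) ℝ) := corr A B '' Sqm

noncomputable def Cmax {m : ℕ} (A B : Matrix (Fin m) (Fin 3) ℝ) :
    Set (Matrix (Fin m) (Fin m) ℝ) := corr A B '' Smax

/-- Support function `φ_K(Z) = sup_{C ∈ K} Tr[Zᵀ C]`. -/
noncomputable def suppFn {m : ℕ} (K : Set (Matrix (Fin m) (Fin m) ℝ))
    (Z : Matrix (Fin m) (Fin m) ℝ) : ℝ :=
  sSup ((fun C => (Zᵀ * C).trace) '' K)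

/-- Gauge function `γ_K(C) = inf {t > 0 : C/t ∈ K}`, with value `+∞` if no such `t` exists. -/
noncomputable def gaugeFn {m : ℕ} (K : Set (Matrix (Fin m) (Fin m) ℝ))
    (C : Matrix (Fin m) (Fin m) ℝ) : ℝ≥0∞ :=
  ⨅ (t : ℝ) (_ : 0 < t ∧ t⁻¹ • C ∈ K), ENNReal.ofReal t

/-- `XᵀX` is Hermitian for a real matrix `X`. -/
lemma isHermitian_tr_mul_self (X : Matrix (Fin 3) (Fin 3) ℝ) : (Xᵀ * X).IsHermitian := by
  simpa [Matrix.conjTranspose_eq_transpose_of_trivial] using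
    Matrix.isHermitian_conjTranspose_mul_self X

/-- The singular values of a real 3×3 matrix, in decreasing order:
`sval X 0 ≥ sval X 1 ≥ sval X 2 ≥ 0` are the square roots of the eigenvalues of `XᵀX`. -/
noncomputable def sval (X : Matrix (Fin 3) (Fin 3) ℝ) (i : Fin 3) : ℝ :=
  Real.sqrt ((isHermitian_tr_mul_self X).eigenvalues
    (Tuple.sort (isHermitian_tr_mul_self X).eigenvalues i.rev))

/-- Column space of a real matrix. -/
noncomputable def colSpace {m n : ℕ} (X : Matrix (Fin m) (Fin n) ℝ) :
    Submodule ℝ (Fin m → ℝ) := LinearMap.range X.mulVecLin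

/-- `Y` is the Moore–Penrose pseudoinverse of `X`. -/
def IsMP {m n : ℕ} (X : Matrix (Fin m) (Fin n) ℝ) (Y : Matrix (Fin n) (Fin m) ℝ) : Prop :=
  X * Y * X = X ∧ Y * X * Y = Y ∧ (X * Y)ᵀ = X * Y ∧ (Y * X)ᵀ = Y * X

/-- The observable `∑ k, u k • σ_k` attached to a real vector `u`. -/
noncomputable def pauliDot (u : Fin 3 → ℝ) : Matrix (Fin 2) (Fin 2) ℂ :=
  ∑ k : Fin 3, (u k : ℂ) • pauli k

/-- The correlation matrix `Tr[ρ (σ_k ⊗ σ_l)]` of a two-qubit matrix `ρ`. -/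
noncomputable def pauliCorr (ρ : Matrix (Fin 2 × Fin 2) (Fin 2 × Fin 2) ℂ) :
    Matrix (Fin 3) (Fin 3) ℝ :=
  Matrix.of fun k l => ((ρ * (pauli k ⊗ₖ pauli l)).trace).re

/-- The two-qubit matrix with maximally mixed marginals and correlation matrix `T`. -/
noncomputable def ofCorr (T : Matrix (Fin 3) (Fin 3) ℝ) :
    Matrix (Fin 2 × Fin 2) (Fin 2 × Fin 2) ℂ :=
  (1 / 4 : ℂ) • (1 + ∑ k, ∑ l, (T k l : ℂ) • (pauli k ⊗ₖ pauli l))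

lemma pauli_isHermitian (k : Fin 3) : (pauli k).IsHermitian := by
  ext i j
  fin_cases k <;> fin_cases i <;> fin_cases j <;> simp [pauli]

lemma pauliDot_isHermitian (u : Fin 3 → ℝ) : (pauliDot u).IsHermitian := by
  simp [pauliDot, IsHermitian, conjTranspose_sum, conjTranspose_smul, (pauli_isHermitian _).eq]

lemma pauliDot_mul_self (u : Fin 3 → ℝ) :
    pauliDot u * pauliDot u = ((∑ k, u k ^ 2 : ℝ) : ℂ) • 1 := by
  ext i j
  fin_cases i <;> fin_cases j <;>
    simp [pauliDot, pauli, Fin.sum_univ_three, Matrix.mul_apply] <;> ring_nf <;>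
    simp [Complex.I_sq]

lemma pauliDot_neg (u : Fin 3 → ℝ) : pauliDot (-u) = -pauliDot u := by
  simp [pauliDot]

lemma posSemidef_one_add_pauliDot {u : Fin 3 → ℝ} (hu : ∑ k, u k ^ 2 = 1) :
    (1 + pauliDot u).PosSemidef := by
  have h := (posSemidef_conjTranspose_mul_self (1 + pauliDot u)).smul
    (show (0 : ℝ) ≤ 1 / 2 by norm_num)
  have hsq : (1 + pauliDot u)ᴴ * (1 + pauliDot u) = (2 : ℝ) • (1 + pauliDot u) := by
    have h2 := pauliDot_mul_self u
    rw [hu] at h2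
    rw [conjTranspose_add, conjTranspose_one, (pauliDot_isHermitian u).eq, two_smul]
    simp only [add_mul, mul_add, one_mul, mul_one, h2]
    simp only [Complex.ofReal_one, one_smul]
    abel
  rw [hsq, smul_smul] at h
  simpa using h

lemma trace_mul_pauliDot_kronecker (ρ : Matrix (Fin 2 × Fin 2) (Fin 2 × Fin 2) ℂ)
    (u v : Fin 3 → ℝ) :
    ((ρ * (pauliDot u ⊗ₖ pauliDot v)).trace).re = u ⬝ᵥ (pauliCorr ρ *ᵥ v) := by
  simp only [pauliDot, pauliCorr, Fin.sum_univ_three, add_kronecker, kronecker_add,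
    smul_kronecker, kronecker_smul, mul_add, trace_add, mul_smul_comm, trace_smul, smul_eq_mul,
    Complex.add_re, Complex.re_ofReal_mul, dotProduct, mulVec, of_apply]
  ring

lemma corr_eq {m : ℕ} (A B : Matrix (Fin m) (Fin 3) ℝ)
    (ρ : Matrix (Fin 2 × Fin 2) (Fin 2 × Fin 2) ℂ) :
    corr A B ρ = A * (pauliCorr ρ * Bᵀ) := by
  ext i j
  exact trace_mul_pauliDot_kronecker ρ (A i) (B j)

lemma trace_transpose_mul_corr {m : ℕ} (A B : Matrix (Fin m) (Fin 3) ℝ)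
    (Z : Matrix (Fin m) (Fin m) ℝ) (ρ : Matrix (Fin 2 × Fin 2) (Fin 2 × Fin 2) ℂ) :
    (Zᵀ * corr A B ρ).trace = ((Aᵀ * Z * B)ᵀ * pauliCorr ρ).trace := by
  rw [corr_eq, ← Matrix.mul_assoc, ← Matrix.mul_assoc, trace_mul_comm]
  simp only [transpose_mul, transpose_transpose, Matrix.mul_assoc]

lemma neg_one_le_of_mem_Smax {ρ : Matrix (Fin 2 × Fin 2) (Fin 2 × Fin 2) ℂ} (hρ : ρ ∈ Smax)
    {u v : Fin 3 → ℝ} (hu : ∑ k, u k ^ 2 = 1) (hv : ∑ k, v k ^ 2 = 1) :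
    -1 ≤ u ⬝ᵥ (pauliCorr ρ *ᵥ v) := by
  obtain ⟨-, htr, hpos⟩ := hρ
  have h1 := hpos _ _ (posSemidef_one_add_pauliDot hu) (posSemidef_one_add_pauliDot hv)
  have h2 := hpos _ _ (posSemidef_one_add_pauliDot (u := -u) (by simpa using hu))
    (posSemidef_one_add_pauliDot (u := -v) (by simpa using hv))
  have h3 := add_nonneg h1 h2
  rw [← Complex.add_re, ← trace_add, ← mul_add] at h3
  have h4 : (1 + pauliDot u) ⊗ₖ (1 + pauliDot v) + (1 + pauliDot (-u)) ⊗ₖ (1 + pauliDot (-v)) =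
      (2 : ℂ) • (1 + pauliDot u ⊗ₖ pauliDot v) := by
    rw [pauliDot_neg, pauliDot_neg, ← one_kronecker_one]
    ext i j
    simp only [Matrix.add_apply, Matrix.smul_apply, kroneckerMap_apply, Matrix.neg_apply, smul_eq_mul]
    ring
  rw [h4, mul_smul_comm, trace_smul, mul_add, trace_add, mul_one, htr] at h3
  have h5 := trace_mul_pauliDot_kronecker ρ u v
  simp at h3
  linarith

lemma dotProduct_pauliCorr_le {ρ : Matrix (Fin 2 × Fin 2) (Fin 2 × Fin 2) ℂ} (hρ : ρ ∈ Smax)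
    {y v : Fin 3 → ℝ} {s : ℝ} (hs : 0 ≤ s) (hy : ∑ k, y k ^ 2 = s ^ 2) (hv : ∑ k, v k ^ 2 = 1) :
    y ⬝ᵥ (pauliCorr ρ *ᵥ v) ≤ s := by
  rcases hs.eq_or_lt with rfl | hs
  · have : y = 0 := by
      funext k
      have := (Finset.sum_eq_zero_iff_of_nonneg (fun k _ => sq_nonneg (y k))).1
        (by simpa using hy) k (Finset.mem_univ k)
      simpa using this
    simp [this]
  · have h := neg_one_le_of_mem_Smax hρ (u := (-s⁻¹) • y) (v := v) (by
      simp only [Pi.smul_apply, smul_eq_mul, mul_pow, ← Finset.mul_sum, hy]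
      field_simp) hv
    rw [smul_dotProduct, smul_eq_mul] at h
    have : s⁻¹ * (y ⬝ᵥ (pauliCorr ρ *ᵥ v)) ≤ 1 := by linarith
    rwa [inv_mul_le_iff₀ hs, mul_one] at this

lemma trace_pauli (k : Fin 3) : (pauli k).trace = 0 := by
  fin_cases k <;> simp [pauli, trace_fin_two]

lemma trace_pauli_mul_pauli (k l : Fin 3) :
    (pauli k * pauli l).trace = if k = l then 2 else 0 := by
  fin_cases k <;> fin_cases l <;> simp [pauli, trace_fin_two] <;> norm_num

lemma trace_ofCorr_mul_kronecker (T : Matrix (Fin 3) (Fin 3) ℝ) (P Q : Matrix (Fin 2) (Fin 2) ℂ) :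
    (ofCorr T * (P ⊗ₖ Q)).trace = (1 / 4 : ℂ) * (P.trace * Q.trace +
      ∑ k, ∑ l, (T k l : ℂ) * ((pauli k * P).trace * (pauli l * Q).trace)) := by
  simp only [ofCorr, smul_mul_assoc, trace_smul, add_mul, one_mul, trace_add, Finset.sum_mul,
    trace_sum, ← mul_kronecker_mul, trace_kronecker, smul_eq_mul]

lemma ofCorr_isHermitian (T : Matrix (Fin 3) (Fin 3) ℝ) : (ofCorr T).IsHermitian := by
  simp [ofCorr, IsHermitian, conjTranspose_sum, conjTranspose_smul, conjTranspose_kronecker,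
    (pauli_isHermitian _).eq]

lemma pauliCorr_ofCorr (T : Matrix (Fin 3) (Fin 3) ℝ) : pauliCorr (ofCorr T) = T := by
  ext k l
  simp only [pauliCorr, of_apply, trace_ofCorr_mul_kronecker, trace_pauli, trace_pauli_mul_pauli]
  rw [Finset.sum_eq_single k, Finset.sum_eq_single l]
  · simp; ring
  · intro b _ hb; simp [hb]
  · simp
  · intro b _ hb; simp [hb]
  · simp

lemma trace_pauli_mul_im {P : Matrix (Fin 2) (Fin 2) ℂ} (hP : P.IsHermitian) (k : Fin 3) :
    (pauli k * P).trace.im = 0 := by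
  rw [← Complex.conj_eq_iff_im]
  change star _ = _
  rw [← trace_conjTranspose, conjTranspose_mul, hP.eq, (pauli_isHermitian k).eq, trace_mul_comm]

lemma bloch_sq_le {P : Matrix (Fin 2) (Fin 2) ℂ} (hP : P.PosSemidef) :
    ∑ k, (pauli k * P).trace.re ^ 2 ≤ P.trace.re ^ 2 := by
  have hd := (Complex.le_def.1 hP.det_nonneg).1
  have h01 := congrFun (congrFun hP.isHermitian.eq 0) 1
  have h00 := congrArg Complex.im (congrFun (congrFun hP.isHermitian.eq 0) 0)
  have h11 := congrArg Complex.im (congrFun (congrFun hP.isHermitian.eq 1) 1)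
  have hr := congrArg Complex.re h01
  have hi := congrArg Complex.im h01
  simp at hr hi h00 h11
  have e0 : (P 0 0).im = 0 := by linarith
  have e1 : (P 1 1).im = 0 := by linarith
  simp [det_fin_two, hr, ← hi, e0, e1] at hd
  simp [Fin.sum_univ_three, pauli, trace_fin_two, vecMul, dotProduct, hr, ← hi]
  nlinarith

lemma ofCorr_mem_Smax {T : Matrix (Fin 3) (Fin 3) ℝ}
    (hT : ∀ v, ∑ k, (T *ᵥ v) k ^ 2 ≤ ∑ k, v k ^ 2) : ofCorr T ∈ Smax := by
  refine ⟨ofCorr_isHermitian T, ?_, fun P Q hP hQ => ?_⟩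
  · have h := trace_ofCorr_mul_kronecker T 1 1
    simp only [one_kronecker_one, mul_one, trace_pauli] at h
    rw [h]
    simp
    norm_num
  · set p : Fin 3 → ℝ := fun k => (pauli k * P).trace.re with hp
    set q : Fin 3 → ℝ := fun k => (pauli k * Q).trace.re with hq
    have hpk : ∀ k, (pauli k * P).trace = (p k : ℂ) := fun k =>
      Complex.ext rfl (trace_pauli_mul_im hP.isHermitian k)
    have hqk : ∀ k, (pauli k * Q).trace = (q k : ℂ) := fun k =>
      Complex.ext rfl (trace_pauli_mul_im hQ.isHermitian k)
    obtain ⟨hp0, hpi⟩ := Complex.le_def.1 hP.trace_nonneg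
    obtain ⟨hq0, hqi⟩ := Complex.le_def.1 hQ.trace_nonneg
    have hP0 : P.trace = (P.trace.re : ℂ) := Complex.ext rfl (by simpa using hpi.symm)
    have hQ0 : Q.trace = (Q.trace.re : ℂ) := Complex.ext rfl (by simpa using hqi.symm)
    have hre : ((ofCorr T * (P ⊗ₖ Q)).trace).re =
        1 / 4 * (P.trace.re * Q.trace.re + ∑ k, p k * (T *ᵥ q) k) := by
      have : (ofCorr T * (P ⊗ₖ Q)).trace =
          ((1 / 4 * (P.trace.re * Q.trace.re + ∑ k, p k * (T *ᵥ q) k) : ℝ) : ℂ) := by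
        rw [trace_ofCorr_mul_kronecker, hP0, hQ0]
        simp only [hpk, hqk, mulVec, dotProduct, Finset.mul_sum]
        push_cast
        simp only [Complex.ofReal_re, mul_left_comm]
      rw [this, Complex.ofReal_re]
    have hcs := Finset.sum_mul_sq_le_sq_mul_sq Finset.univ p (T *ᵥ q)
    have hb : (∑ k, p k * (T *ᵥ q) k) ^ 2 ≤ (P.trace.re * Q.trace.re) ^ 2 := by
      rw [mul_pow]
      refine hcs.trans (mul_le_mul (bloch_sq_le hP) ((hT q).trans (bloch_sq_le hQ))
        (Finset.sum_nonneg fun _ _ => sq_nonneg _) (sq_nonneg _))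
    have := (abs_le_of_sq_le_sq' hb (mul_nonneg hp0 hq0)).1
    rw [hre]
    linarith

lemma sum_sval (X : Matrix (Fin 3) (Fin 3) ℝ) :
    sval X 0 + sval X 1 + sval X 2 =
      ∑ i, Real.sqrt ((isHermitian_tr_mul_self X).eigenvalues i) := by
  rw [← Fin.sum_univ_three (sval X)]
  exact Equiv.sum_comp (Fin.revPerm.trans (Tuple.sort (isHermitian_tr_mul_self X).eigenvalues))
    (fun i => Real.sqrt ((isHermitian_tr_mul_self X).eigenvalues i))

/-- An orthogonal diagonalization of `XᵀX`. -/
lemma exists_orthogonal_diagonalization (X : Matrix (Fin 3) (Fin 3) ℝ) :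
    ∃ V : Matrix (Fin 3) (Fin 3) ℝ, Vᵀ * V = 1 ∧ V * Vᵀ = 1 ∧
      (X * V)ᵀ * (X * V) = diagonal (isHermitian_tr_mul_self X).eigenvalues := by
  have hH := isHermitian_tr_mul_self X
  have hst : (star (hH.eigenvectorUnitary : Matrix (Fin 3) (Fin 3) ℝ)) =
      (hH.eigenvectorUnitary : Matrix (Fin 3) (Fin 3) ℝ)ᵀ := by
    rw [star_eq_conjTranspose, conjTranspose_eq_transpose_of_trivial]
  have h1 := Unitary.coe_star_mul_self hH.eigenvectorUnitary
  have h2 := Unitary.coe_mul_star_self hH.eigenvectorUnitary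
  rw [hst] at h1
  rw [Unitary.coe_star, hst] at h2
  refine ⟨hH.eigenvectorUnitary, h1, h2, ?_⟩
  have h := hH.spectral_theorem
  rw [Unitary.conjStarAlgAut_apply, hst] at h
  have h' := congrArg (· * (hH.eigenvectorUnitary : Matrix (Fin 3) (Fin 3) ℝ)) h
  simp only [Matrix.mul_assoc, h1, Matrix.mul_one] at h'
  rw [transpose_mul, Matrix.mul_assoc, h', ← Matrix.mul_assoc, h1, Matrix.one_mul]
  rfl

lemma eigenvalues_tr_mul_self_nonneg (X : Matrix (Fin 3) (Fin 3) ℝ) (i : Fin 3) :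
    0 ≤ (isHermitian_tr_mul_self X).eigenvalues i := by
  have h : (Xᵀ * X).PosSemidef := by
    simpa [conjTranspose_eq_transpose_of_trivial] using posSemidef_conjTranspose_mul_self X
  exact h.eigenvalues_nonneg i

/-- The trace norm of `X` is attained at a contraction. -/
lemma exists_contraction_trace_eq (X : Matrix (Fin 3) (Fin 3) ℝ) :
    ∃ T : Matrix (Fin 3) (Fin 3) ℝ, (∀ v, ∑ k, (T *ᵥ v) k ^ 2 ≤ ∑ k, v k ^ 2) ∧
      (Xᵀ * T).trace = sval X 0 + sval X 1 + sval X 2 := by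
  obtain ⟨V, hVV, hVV', hX⟩ := exists_orthogonal_diagonalization X
  have hnn := eigenvalues_tr_mul_self_nonneg X
  rw [sum_sval]
  set e := (isHermitian_tr_mul_self X).eigenvalues
  set d : Fin 3 → ℝ := fun i => (Real.sqrt (e i))⁻¹
  have hsum : ∀ w : Fin 3 → ℝ, ∑ k, w k ^ 2 = w ⬝ᵥ w := fun w => by simp [dotProduct, sq]
  have hmul : ∀ (M : Matrix (Fin 3) (Fin 3) ℝ) w, (M *ᵥ w) ⬝ᵥ (M *ᵥ w) = w ⬝ᵥ ((Mᵀ * M) *ᵥ w) :=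
    fun M w => by
      rw [← mulVec_mulVec, dotProduct_mulVec w, vecMul_transpose]
  refine ⟨X * V * diagonal d * Vᵀ, fun v => ?_, ?_⟩
  · set w := Vᵀ *ᵥ v
    have hw : ∑ k, v k ^ 2 = ∑ k, w k ^ 2 := by
      rw [hsum, hsum, hmul, transpose_transpose, hVV', one_mulVec]
    rw [hw, ← mulVec_mulVec, ← mulVec_mulVec, hsum, hmul, hX, dotProduct]
    refine Finset.sum_le_sum fun k _ => ?_
    simp only [mulVec_diagonal]
    have : d k * w k * (e k * (d k * w k)) = (d k ^ 2 * e k) * w k ^ 2 := by ring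
    rw [this]
    refine mul_le_of_le_one_left (sq_nonneg _) ?_
    simp only [d, inv_pow, Real.sq_sqrt (hnn k)]
    exact inv_mul_le_one
  · have h1 : (Xᵀ * (X * V * diagonal d * Vᵀ)).trace = ((X * V)ᵀ * (X * V) * diagonal d).trace := by
      rw [← Matrix.mul_assoc, trace_mul_comm, transpose_mul]
      simp only [Matrix.mul_assoc]
    rw [h1, hX, diagonal_mul_diagonal, trace_diagonal]
    refine Finset.sum_congr rfl fun i _ => ?_
    simp only [d, ← div_eq_mul_inv, Real.div_sqrt]

lemma trace_mul_pauliCorr_le {ρ : Matrix (Fin 2 × Fin 2) (Fin 2 × Fin 2) ℂ} (hρ : ρ ∈ Smax)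
    (X : Matrix (Fin 3) (Fin 3) ℝ) :
    (Xᵀ * pauliCorr ρ).trace ≤ sval X 0 + sval X 1 + sval X 2 := by
  obtain ⟨V, hVV, hVV', hX⟩ := exists_orthogonal_diagonalization X
  have hnn := eigenvalues_tr_mul_self_nonneg X
  rw [sum_sval]
  have h1 : (Xᵀ * pauliCorr ρ).trace = ((X * V)ᵀ * (pauliCorr ρ * V)).trace := by
    rw [transpose_mul, Matrix.mul_assoc Vᵀ, trace_mul_comm Vᵀ, Matrix.mul_assoc, Matrix.mul_assoc,
      hVV', Matrix.mul_one]
  rw [h1]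
  refine Finset.sum_le_sum fun i _ => ?_
  refine dotProduct_pauliCorr_le hρ (y := fun k => (X * V) k i) (v := fun k => V k i)
    (Real.sqrt_nonneg _) ?_ ?_
  · have h := congrFun (congrFun hX i) i
    rw [diagonal_apply_eq] at h
    rw [Real.sq_sqrt (hnn i), ← h, Matrix.mul_apply]
    simp only [transpose_apply, sq]
  · have h := congrFun (congrFun hVV i) i
    rw [one_apply_eq] at h
    rw [← h, Matrix.mul_apply]
    simp only [transpose_apply, sq]

/-- Support function of the maximal correlation set:
`φ_{C_max}(Z) = ‖AᵀZB‖₁ = s₁ + s₂ + s₃`. -/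
theorem stmt4 {m : ℕ} (hm : 1 ≤ m) (A B : Matrix (Fin m) (Fin 3) ℝ)
    (hA : ∀ i, ∑ k, A i k ^ 2 = 1) (hB : ∀ i, ∑ k, B i k ^ 2 = 1)
    (Z : Matrix (Fin m) (Fin m) ℝ) :
    suppFn (Cmax A B) Z =
      sval (Aᵀ * Z * B) 0 + sval (Aᵀ * Z * B) 1 + sval (Aᵀ * Z * B) 2 := by
  refine IsGreatest.csSup_eq ⟨?_, ?_⟩
  · obtain ⟨T, hT, hTr⟩ := exists_contraction_trace_eq (Aᵀ * Z * B)
    refine ⟨_, ⟨ofCorr T, ofCorr_mem_Smax hT, rfl⟩, ?_⟩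
    change (Zᵀ * corr A B (ofCorr T)).trace = _
    rw [trace_transpose_mul_corr, pauliCorr_ofCorr, hTr]
  · rintro _ ⟨_, ⟨ρ, hρ, rfl⟩, rfl⟩
    change (Zᵀ * corr A B ρ).trace ≤ _
    rw [trace_transpose_mul_corr]
    exact trace_mul_pauliCorr_le hρ _

end BellCorr
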